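/- The Lie subalgebra of the ℂ-linear endomorphisms of ℂ[[z]] (with bracket [f,g]=f∘g−g∘f) generated by the set {D∘L^n : n ≥ 0} equals the ℂ-linear span of {D∘L^n : n ≥ 0}. -/

import Mathlib

noncomputable section

/-- The formal differentiation operator `D` on `ℂ[[z]]`: `(Df)(z) = ∑ (k+1) c_{k+1} z^k`. -/
def Dop : Module.End ℂ (PowerSeries ℂ) where
  toFun f := PowerSeries.mk fun k => ((k : ℂ) + 1) * PowerSeries.coeff (k + 1) f
  map_add' f g := by
    ext k
    simp [mul_add]
  map_smul' c f := by
    ext k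
    simp
    ring

/-- The left translation operator `L` on `ℂ[[z]]`: `(Lf)(z) = ∑ c_{k+1} z^k`. -/
def Lop : Module.End ℂ (PowerSeries ℂ) where
  toFun f := PowerSeries.mk fun k => PowerSeries.coeff (k + 1) f
  map_add' f g := by ext k; simp
  map_smul' c f := by ext k; simp

attribute [local instance 100] LieRing.ofAssociativeRing

theorem coeff_Lop_pow (n k : ℕ) (f : PowerSeries ℂ) :
    PowerSeries.coeff k ((Lop ^ n) f) = PowerSeries.coeff (k + n) f := by
  induction n generalizing k with
  | zero => simp
  | succ n ih =>
    rw [pow_succ', Module.End.mul_apply]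
    simp only [Lop, LinearMap.coe_mk, AddHom.coe_mk, PowerSeries.coeff_mk]
    rw [show k + (n + 1) = k + 1 + n by ring]
    exact ih (k + 1)

theorem coeff_Dop_mul_Lop_pow (n k : ℕ) (f : PowerSeries ℂ) :
    PowerSeries.coeff k ((Dop * Lop ^ n) f) =
      ((k : ℂ) + 1) * PowerSeries.coeff (k + 1 + n) f := by
  rw [Module.End.mul_apply, ← coeff_Lop_pow]
  simp only [Dop, LinearMap.coe_mk, AddHom.coe_mk, PowerSeries.coeff_mk]

theorem lie_Dop_mul_Lop_pow (n m : ℕ) :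
    ⁅Dop * Lop ^ n, Dop * Lop ^ m⁆ = ((n : ℂ) - m) • (Dop * Lop ^ (n + m + 1)) := by
  ext f k
  rw [Ring.lie_def, LinearMap.sub_apply, LinearMap.smul_apply, map_sub, map_smul,
    Module.End.mul_apply (Dop * Lop ^ n), Module.End.mul_apply (Dop * Lop ^ m)]
  simp only [coeff_Dop_mul_Lop_pow, smul_eq_mul]
  rw [show k + 1 + n + 1 + m = k + 1 + (n + m + 1) by ring,
    show k + 1 + m + 1 + n = k + 1 + (n + m + 1) by ring]
  push_cast
  ring

theorem lie_mem_span_Dop_mul_Lop_pow {x y : Module.End ℂ (PowerSeries ℂ)}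
    (hx : x ∈ Submodule.span ℂ {f : Module.End ℂ (PowerSeries ℂ) | ∃ n : ℕ, f = Dop * Lop ^ n})
    (hy : y ∈ Submodule.span ℂ {f : Module.End ℂ (PowerSeries ℂ) | ∃ n : ℕ, f = Dop * Lop ^ n}) :
    ⁅x, y⁆ ∈ Submodule.span ℂ
      {f : Module.End ℂ (PowerSeries ℂ) | ∃ n : ℕ, f = Dop * Lop ^ n} := by
  induction hx, hy using Submodule.span_induction₂ with
  | mem_mem x y hx hy =>
    obtain ⟨n, rfl⟩ := hx
    obtain ⟨m, rfl⟩ := hy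
    rw [lie_Dop_mul_Lop_pow]
    exact Submodule.smul_mem _ _ (Submodule.subset_span ⟨_, rfl⟩)
  | zero_left y hy => rw [zero_lie]; exact Submodule.zero_mem _
  | zero_right x hx => rw [lie_zero]; exact Submodule.zero_mem _
  | add_left x y z _ _ _ h₁ h₂ => rw [add_lie]; exact Submodule.add_mem _ h₁ h₂
  | add_right x y z _ _ _ h₁ h₂ => rw [lie_add]; exact Submodule.add_mem _ h₁ h₂
  | smul_left r x y _ _ h => rw [smul_lie]; exact Submodule.smul_mem _ _ h
  | smul_right r x y _ _ h => rw [lie_smul]; exact Submodule.smul_mem _ _ h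

/-- the Lie subalgebra of `Module.End ℂ ℂ[[z]]` (with `⁅f,g⁆ = f∘g − g∘f`)
generated by `{D∘Lⁿ : n ≥ 0}` coincides with the `ℂ`-linear span of `{D∘Lⁿ : n ≥ 0}`. -/
theorem lieSpan_DL_eq_span :
    (LieSubalgebra.lieSpan ℂ (Module.End ℂ (PowerSeries ℂ))
        {f | ∃ n : ℕ, f = Dop * Lop ^ n} : Set (Module.End ℂ (PowerSeries ℂ))) =
      (Submodule.span ℂ {f : Module.End ℂ (PowerSeries ℂ) | ∃ n : ℕ, f = Dop * Lop ^ n} :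
        Set (Module.End ℂ (PowerSeries ℂ))) := by
  apply Set.Subset.antisymm
  · let K : LieSubalgebra ℂ (Module.End ℂ (PowerSeries ℂ)) :=
      { Submodule.span ℂ {f : Module.End ℂ (PowerSeries ℂ) | ∃ n : ℕ, f = Dop * Lop ^ n} with
        lie_mem' := lie_mem_span_Dop_mul_Lop_pow }
    have h : LieSubalgebra.lieSpan ℂ (Module.End ℂ (PowerSeries ℂ))
        {f | ∃ n : ℕ, f = Dop * Lop ^ n} ≤ K :=
      LieSubalgebra.lieSpan_le.mpr Submodule.subset_span
    exact h
  · exact LieSubalgebra.submodule_span_le_lieSpan
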